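/- Let 𝕜 be ℝ or ℂ, V an inner product space over 𝕜, let φ, ψ : V →ₗ[𝕜] V be finite potent endomorphisms, each with index at most 1, and let X be a core inverse of φ. Then φ ∘ X = ψ ∘ X and X ∘ φ = X ∘ ψ (φ is below ψ in the core order) if and only if φ v = ψ v for every v ∈ LinearMap.range φ and ψ v ∈ (LinearMap.range φ)ᗮ for every v ∈ LinearMap.ker φ. -/

import Mathlib

theorem core_stmt17 {𝕜 : Type*} [RCLike 𝕜] {V : Type*} [NormedAddCommGroup V]
    [InnerProductSpace 𝕜 V] (φ ψ X : V →ₗ[𝕜] V)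
    (hfpφ : ∃ n : ℕ, FiniteDimensional 𝕜 (LinearMap.range (φ ^ n)))
    (hidxφ : IsCompl (LinearMap.range φ) (LinearMap.ker φ))
    (hfpψ : ∃ n : ℕ, FiniteDimensional 𝕜 (LinearMap.range (ψ ^ n)))
    (hidxψ : IsCompl (LinearMap.range ψ) (LinearMap.ker ψ))
    (hX1 : ∀ v : V, v - φ (X v) ∈ (LinearMap.range φ)ᗮ)
    (hX2 : LinearMap.range X ≤ LinearMap.range φ) :
    (φ ∘ₗ X = ψ ∘ₗ X ∧ X ∘ₗ φ = X ∘ₗ ψ) ↔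
      ((∀ v ∈ LinearMap.range φ, φ v = ψ v) ∧
        (∀ v ∈ LinearMap.ker φ, ψ v ∈ (LinearMap.range φ)ᗮ)) := by
  have hperp : ∀ w, w ∈ LinearMap.range φ → w ∈ (LinearMap.range φ)ᗮ → w = 0 := fun w h1 h2 =>
    (Submodule.disjoint_def.1 (Submodule.orthogonal_disjoint (LinearMap.range φ))) w h1 h2
  have hker : ∀ w, w ∈ LinearMap.range φ → φ w = 0 → w = 0 := fun w h1 h2 =>
    (Submodule.disjoint_def.1 hidxφ.disjoint) w h1 (LinearMap.mem_ker.2 h2)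
  have hXr : ∀ v, X v ∈ LinearMap.range φ := fun v => hX2 ⟨v, rfl⟩
  have K1 : ∀ v ∈ LinearMap.range φ, X (φ v) = v := by
    intro v hv
    have h := hperp _ (Submodule.sub_mem _ ⟨v, rfl⟩ ⟨_, rfl⟩) (hX1 (φ v))
    have h2 := hker (v - X (φ v)) (Submodule.sub_mem _ hv (hXr _)) (by rw [map_sub]; exact h)
    exact (sub_eq_zero.1 h2).symm
  have K2 : ∀ w ∈ (LinearMap.range φ)ᗮ, X w = 0 := by
    intro w hw
    apply hker _ (hXr w)
    apply hperp _ ⟨_, rfl⟩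
    have h := Submodule.sub_mem _ hw (hX1 w)
    simpa using h
  constructor
  · rintro ⟨h1, h2⟩
    refine ⟨fun v hv => ?_, fun v hv => ?_⟩
    · have h := LinearMap.congr_fun h1 (φ v)
      simpa [K1 v hv] using h
    · have h := LinearMap.congr_fun h2 v
      have h3 := hX1 (ψ v)
      simp only [LinearMap.comp_apply, LinearMap.mem_ker.1 hv, map_zero] at h
      rw [← h] at h3
      simpa using h3
  · rintro ⟨h1, h2⟩
    refine ⟨LinearMap.ext fun v => h1 _ (hXr v), LinearMap.ext fun v => ?_⟩
    have hv : v ∈ LinearMap.range φ ⊔ LinearMap.ker φ := by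
      rw [hidxφ.sup_eq_top]; trivial
    obtain ⟨r, hr, k, hk, rfl⟩ := Submodule.mem_sup.1 hv
    simp only [LinearMap.comp_apply, map_add, LinearMap.mem_ker.1 hk, h1 r hr, K2 _ (h2 k hk),
      map_zero]
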